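/- Let λ > 0 and f ∈ ℝ, and let q ≥ 0, r ≥ 0, α, φ ∈ ℝ. Then the diffraction integral of a single Gaussian radial basis function with defocus factor exp(i f ρ²), namely U = (1/π)·∫_0^1 ∫_0^{2π} exp(i f ρ²)·exp(−λ(q² + ρ² − 2ρq·cos(θ−α)))·exp(2πi·rρ·cos(θ−φ))·ρ dθ dρ, equals e^{−λq²}·Σ_{s=0}^∞ (m_s(λ − i f)/(s!)²)·Ω^s, where Ω = Ω(r,φ;q,α) = λ²q² + 2πi·rλq·cos(φ−α) − π²r² and m_s(μ) = ∫_0^1 e^{−μρ}·ρ^s dρ; moreover the series converges absolutely. -/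

import Mathlib

open MeasureTheory

/-- `m_s(μ) = ∫_0^1 e^{−μρ}·ρ^s dρ`. -/
noncomputable def m (s : ℕ) (μ : ℂ) : ℂ :=
  ∫ ρ in (0:ℝ)..1, Complex.exp (-μ * (ρ:ℂ)) * (ρ:ℂ) ^ s

/-- `Ω(r,φ;q,α) = λ²q² + 2πi·rλq·cos(φ−α) − π²r²` (shape parameter `l`). -/
noncomputable def Om (l r φ q α : ℝ) : ℂ :=
  (l : ℂ) ^ 2 * (q : ℂ) ^ 2
    + 2 * (Real.pi : ℂ) * Complex.I * (r : ℂ) * (l : ℂ) * (q : ℂ) * (Real.cos (φ - α) : ℂ)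
    - (Real.pi : ℂ) ^ 2 * (r : ℂ) ^ 2

/-- Term-by-term integration of a series with constant majorants. -/
theorem hasSum_intervalIntegral_of_norm_le_const {a b : ℝ} {F : ℕ → ℝ → ℂ} {g : ℝ → ℂ}
    {u : ℕ → ℝ} (hF : ∀ n, Continuous (F n)) (hu : Summable u)
    (hFu : ∀ n, ∀ x ∈ Set.uIoc a b, ‖F n x‖ ≤ u n)
    (hg : ∀ x ∈ Set.uIoc a b, HasSum (fun n => F n x) (g x)) :
    HasSum (fun n => ∫ x in a..b, F n x) (∫ x in a..b, g x) :=
  intervalIntegral.hasSum_integral_of_dominated_convergence (fun n _ => u n)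
    (fun n => (hF n).aestronglyMeasurable)
    (fun n => ae_of_all _ (hFu n)) (ae_of_all _ fun _ _ => hu)
    intervalIntegrable_const (ae_of_all _ hg)

theorem Complex.hasSum_pow_div_factorial (z : ℂ) :
    HasSum (fun n : ℕ => z ^ n / (n.factorial : ℂ)) (Complex.exp z) := by
  rw [Complex.exp_eq_exp_ℂ]
  exact NormedSpace.expSeries_div_hasSum_exp z

/-- Orthogonality of the characters of the circle. -/
theorem integral_exp_int_mul_I (k : ℤ) :
    ∫ θ in (0:ℝ)..(2 * Real.pi), Complex.exp (k * (θ * Complex.I)) =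
      if k = 0 then 2 * (Real.pi : ℂ) else 0 := by
  split_ifs with hk
  · simp [hk]
  · have hc : (k : ℂ) * Complex.I ≠ 0 := mul_ne_zero (by exact_mod_cast hk) Complex.I_ne_zero
    have h := integral_exp_mul_complex (a := 0) (b := 2 * Real.pi) hc
    have e : Complex.exp ((k : ℂ) * Complex.I * ((2 * Real.pi : ℝ) : ℂ)) = 1 := by
      rw [← Complex.exp_int_mul_two_pi_mul_I k]
      push_cast
      ring_nf
    rw [e] at h
    simpa [mul_assoc, mul_comm, mul_left_comm] using h

/-- The Fourier coefficients of `exp (A e^{iθ})`. -/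
theorem integral_exp_circle_mul_exp_neg (A : ℂ) (n : ℕ) :
    ∫ θ in (0:ℝ)..(2 * Real.pi),
        Complex.exp (A * Complex.exp (θ * Complex.I)) * Complex.exp (-(θ * Complex.I)) ^ n =
      2 * (Real.pi : ℂ) * (A ^ n / (n.factorial : ℂ)) := by
  have h := hasSum_intervalIntegral_of_norm_le_const (a := 0) (b := 2 * Real.pi)
    (F := fun k θ => A ^ k / (k.factorial : ℂ) *
      Complex.exp (((k : ℤ) - (n : ℤ) : ℤ) * (θ * Complex.I)))
    (g := fun θ => Complex.exp (A * Complex.exp (θ * Complex.I)) *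
      Complex.exp (-(θ * Complex.I)) ^ n)
    (fun k => by fun_prop) (Real.summable_pow_div_factorial ‖A‖)
    (fun k θ _ => by
      have e : ((((k : ℤ) - (n : ℤ) : ℤ) : ℂ)) * (θ * Complex.I) =
        (((k : ℝ) - n) * θ : ℝ) * Complex.I := by push_cast; ring
      rw [norm_mul, e, Complex.norm_exp_ofReal_mul_I]
      simp)
    (fun θ _ => by
      convert! (Complex.hasSum_pow_div_factorial (A * Complex.exp (θ * Complex.I))).mul_right
        (Complex.exp (-(θ * Complex.I)) ^ n) using 2 with k
      have e : ((((k : ℤ) - (n : ℤ) : ℤ) : ℂ)) * (θ * Complex.I) =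
        k * (θ * Complex.I) + n * (-(θ * Complex.I)) := by push_cast; ring
      rw [e, Complex.exp_add, Complex.exp_nat_mul, Complex.exp_nat_mul, mul_pow]
      ring)
  refine h.unique ?_
  simp only [intervalIntegral.integral_const_mul, integral_exp_int_mul_I]
  convert! hasSum_ite_eq n (2 * (Real.pi : ℂ) * (A ^ n / (n.factorial : ℂ))) using 2 with k
  by_cases hk : k = n
  · subst hk; simp [mul_comm]
  · have : (k : ℤ) - n ≠ 0 := by omega
    simp [hk, this]

theorem norm_div_factorial_sq_le (z : ℂ) (n : ℕ) :
    ‖z / (n.factorial : ℂ) ^ 2‖ ≤ ‖z‖ / n.factorial := by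
  rw [norm_div, norm_pow, Complex.norm_natCast]
  have h : (1 : ℝ) ≤ n.factorial := by exact_mod_cast n.factorial_pos
  gcongr
  nlinarith

/-- The generating integral of the modified Bessel function `I₀`. -/
theorem hasSum_integral_exp_circle (A B : ℂ) :
    HasSum (fun n : ℕ => 2 * (Real.pi : ℂ) * ((A * B) ^ n / (n.factorial : ℂ) ^ 2))
      (∫ θ in (0:ℝ)..(2 * Real.pi),
        Complex.exp (A * Complex.exp (θ * Complex.I) + B * Complex.exp (-(θ * Complex.I)))) := by
  have h := hasSum_intervalIntegral_of_norm_le_const (a := 0) (b := 2 * Real.pi)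
    (F := fun n θ => B ^ n / (n.factorial : ℂ) *
      (Complex.exp (A * Complex.exp (θ * Complex.I)) * Complex.exp (-(θ * Complex.I)) ^ n))
    (g := fun θ => Complex.exp (A * Complex.exp (θ * Complex.I) +
      B * Complex.exp (-(θ * Complex.I))))
    (fun k => by fun_prop) ((Real.summable_pow_div_factorial ‖B‖).mul_right (Real.exp ‖A‖))
    (fun n θ _ => by
      have e : -((θ : ℂ) * Complex.I) = ((-θ : ℝ) : ℂ) * Complex.I := by push_cast; ring
      rw [norm_mul, norm_mul, norm_pow, e, Complex.norm_exp_ofReal_mul_I, norm_div, norm_pow,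
        Complex.norm_natCast, one_pow, mul_one]
      gcongr
      refine (Complex.norm_exp_le_exp_norm _).trans ?_
      rw [norm_mul, Complex.norm_exp_ofReal_mul_I, mul_one])
    (fun θ _ => by
      convert! (Complex.hasSum_pow_div_factorial (B * Complex.exp (-(θ * Complex.I)))).mul_left
        (Complex.exp (A * Complex.exp (θ * Complex.I))) using 1
      · funext n; rw [mul_pow]; ring
      · rw [Complex.exp_add])
  convert! h using 2 with n
  rw [intervalIntegral.integral_const_mul, integral_exp_circle_mul_exp_neg, mul_pow]
  ring

/-- The substitution `t = ρ²` in the moments `m`. -/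
theorem integral_exp_neg_mul_sq_eq_m (s : ℕ) (μ : ℂ) :
    ∫ ρ in (0:ℝ)..1, 2 * (ρ : ℂ) * (Complex.exp (-μ * (ρ : ℂ) ^ 2) * ((ρ : ℂ) ^ 2) ^ s) =
      m s μ := by
  have h := intervalIntegral.integral_deriv_smul_comp (a := 0) (b := 1)
    (f := fun x : ℝ => x ^ 2) (f' := fun x => 2 * x)
    (g := fun ρ : ℝ => Complex.exp (-μ * (ρ : ℂ)) * (ρ : ℂ) ^ s)
    (fun x _ => by simpa using hasDerivAt_pow 2 x) (by fun_prop) (by fun_prop)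
  simpa [m] using h

theorem norm_exp_neg_mul_le {x : ℝ} (hx : x ∈ Set.Icc (0 : ℝ) 1) (μ : ℂ) :
    ‖Complex.exp (-μ * x)‖ ≤ Real.exp ‖μ‖ := by
  refine (Complex.norm_exp_le_exp_norm _).trans (Real.exp_le_exp.2 ?_)
  rw [norm_mul, norm_neg, Complex.norm_real, Real.norm_of_nonneg hx.1]
  exact mul_le_of_le_one_right (norm_nonneg _) hx.2

theorem norm_m_le (s : ℕ) (μ : ℂ) : ‖m s μ‖ ≤ Real.exp ‖μ‖ := by
  have h := intervalIntegral.norm_integral_le_of_norm_le_const (a := 0) (b := 1)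
    (C := Real.exp ‖μ‖) (f := fun ρ : ℝ => Complex.exp (-μ * (ρ : ℂ)) * (ρ : ℂ) ^ s)
    (fun x hx => by
      rw [Set.uIoc_of_le zero_le_one] at hx
      rw [norm_mul, norm_pow, Complex.norm_real, Real.norm_of_nonneg hx.1.le]
      exact (mul_le_of_le_one_right (norm_nonneg _) (pow_le_one₀ hx.1.le hx.2)).trans
        (norm_exp_neg_mul_le ⟨hx.1.le, hx.2⟩ μ))
  simpa [m] using h

theorem summable_norm_m_mul_pow (μ w : ℂ) :
    Summable fun s : ℕ => ‖m s μ / (s.factorial : ℂ) ^ 2 * w ^ s‖ := by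
  refine .of_nonneg_of_le (fun _ => norm_nonneg _) (fun s => ?_)
    ((Real.summable_pow_div_factorial ‖w‖).mul_left (Real.exp ‖μ‖))
  calc ‖m s μ / (s.factorial : ℂ) ^ 2 * w ^ s‖
      = ‖m s μ‖ * ‖w ^ s / (s.factorial : ℂ) ^ 2‖ := by rw [← norm_mul]; congr 1; ring
    _ ≤ Real.exp ‖μ‖ * (‖w‖ ^ s / s.factorial) := by
      gcongr
      · exact norm_m_le s μ
      · simpa using norm_div_factorial_sq_le (w ^ s) s

/-- Radial integration of the series of `hasSum_integral_exp_circle`. -/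
theorem hasSum_integral_radial (μ w : ℂ) {g : ℝ → ℂ}
    (hg : ∀ ρ : ℝ, HasSum (fun s : ℕ => 2 * (ρ : ℂ) * Complex.exp (-μ * (ρ : ℂ) ^ 2) *
      (((ρ : ℂ) ^ 2 * w) ^ s / (s.factorial : ℂ) ^ 2)) (g ρ)) :
    HasSum (fun s : ℕ => m s μ / (s.factorial : ℂ) ^ 2 * w ^ s) (∫ ρ in (0:ℝ)..1, g ρ) := by
  have h := hasSum_intervalIntegral_of_norm_le_const (a := 0) (b := 1)
    (F := fun s ρ => 2 * (ρ : ℂ) * Complex.exp (-μ * (ρ : ℂ) ^ 2) *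
      (((ρ : ℂ) ^ 2 * w) ^ s / (s.factorial : ℂ) ^ 2)) (g := g)
    (fun k => by fun_prop) ((Real.summable_pow_div_factorial ‖w‖).mul_left
      (2 * 1 * Real.exp ‖μ‖))
    (fun s ρ hρ => by
      rw [Set.uIoc_of_le zero_le_one] at hρ
      have hn : ‖(ρ : ℂ)‖ ≤ 1 := by
        rw [Complex.norm_real, Real.norm_of_nonneg hρ.1.le]; exact hρ.2
      have he : ‖Complex.exp (-μ * (ρ : ℂ) ^ 2)‖ ≤ Real.exp ‖μ‖ := by
        simpa using norm_exp_neg_mul_le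
          (⟨sq_nonneg ρ, pow_le_one₀ hρ.1.le hρ.2⟩ : ρ ^ 2 ∈ Set.Icc (0 : ℝ) 1) μ
      have hw : ‖((ρ : ℂ) ^ 2 * w) ^ s / (s.factorial : ℂ) ^ 2‖ ≤ ‖w‖ ^ s / s.factorial := by
        refine (norm_div_factorial_sq_le _ s).trans ?_
        rw [norm_pow, norm_mul, norm_pow]
        gcongr
        exact mul_le_of_le_one_left (norm_nonneg _) (pow_le_one₀ (norm_nonneg _) hn)
      rw [norm_mul, norm_mul, norm_mul, Complex.norm_ofNat]
      gcongr)
    (fun ρ _ => hg ρ)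
  convert! h using 2 with s
  rw [← integral_exp_neg_mul_sq_eq_m, div_mul_eq_mul_div, div_eq_mul_inv, mul_assoc,
    ← intervalIntegral.integral_mul_const]
  refine intervalIntegral.integral_congr fun ρ _ => ?_
  simp only [mul_pow]
  ring

/-- The angular integral of a Gaussian times a plane wave. -/
theorem hasSum_integral_angular (l f q r α φ ρ : ℝ) :
    HasSum (fun s : ℕ => 2 * (ρ : ℂ) *
        Complex.exp (-((l : ℂ) - Complex.I * (f:ℂ)) * (ρ : ℂ) ^ 2) *
        (((ρ : ℂ) ^ 2 * Om l r φ q α) ^ s / (s.factorial : ℂ) ^ 2))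
      ((1 / (Real.pi : ℂ)) * Complex.exp ((l : ℂ) * (q:ℂ)^2) *
        ∫ θ in (0:ℝ)..(2 * Real.pi),
          Complex.exp (Complex.I * (f:ℂ) * (ρ:ℂ)^2)
            * Complex.exp (-(l : ℂ) * ((q:ℂ)^2 + (ρ:ℂ)^2
              - 2 * (ρ:ℂ) * (q:ℂ) * (Real.cos (θ - α) : ℂ)))
            * Complex.exp (2 * (Real.pi : ℂ) * Complex.I * (r:ℂ) * (ρ:ℂ)
              * (Real.cos (θ - φ) : ℂ))
            * (ρ:ℂ)) := by
  have hπ : (Real.pi : ℂ) ≠ 0 := by exact_mod_cast Real.pi_ne_zero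
  set E : ℝ → ℂ := fun x => Complex.exp (x * Complex.I) with hE
  have E_add (x y : ℝ) : E (x + y) = E x * E y := by
    simp only [hE, ← Complex.exp_add]; push_cast; ring_nf
  have E_zero : E 0 = 1 := by simp [hE]
  have E_cos (x : ℝ) : (Real.cos x : ℂ) = (E x + E (-x)) / 2 := by
    simp [hE, Complex.cos]
  set A : ℂ := ρ * (l * q * E (-α) + Real.pi * Complex.I * r * E (-φ)) with hA
  set B : ℂ := ρ * (l * q * E α + Real.pi * Complex.I * r * E φ) with hB
  have hAB : A * B = (ρ : ℂ) ^ 2 * Om l r φ q α := by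
    have e₁ : E α * E (-α) = 1 := by rw [← E_add]; simp [E_zero]
    have e₂ : E φ * E (-φ) = 1 := by rw [← E_add]; simp [E_zero]
    have e₃ : E (φ - α) = E φ * E (-α) := by rw [← E_add, sub_eq_add_neg]
    have e₄ : E (-(φ - α)) = E α * E (-φ) := by rw [← E_add]; ring_nf
    rw [Om, E_cos, e₃, e₄, hA, hB]
    linear_combination (ρ : ℂ) ^ 2 * l ^ 2 * q ^ 2 * e₁ -
      (ρ : ℂ) ^ 2 * Real.pi ^ 2 * r ^ 2 * e₂ +
      (ρ : ℂ) ^ 2 * Real.pi ^ 2 * r ^ 2 * E φ * E (-φ) * Complex.I_sq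
  have hint (θ : ℝ) :
      Complex.exp (Complex.I * (f:ℂ) * (ρ:ℂ)^2)
            * Complex.exp (-(l : ℂ) * ((q:ℂ)^2 + (ρ:ℂ)^2
              - 2 * (ρ:ℂ) * (q:ℂ) * (Real.cos (θ - α) : ℂ)))
            * Complex.exp (2 * (Real.pi : ℂ) * Complex.I * (r:ℂ) * (ρ:ℂ)
              * (Real.cos (θ - φ) : ℂ))
            * (ρ:ℂ) =
        ρ * Complex.exp (-((l : ℂ) - Complex.I * (f:ℂ)) * (ρ : ℂ) ^ 2)
          * Complex.exp (-((l : ℂ) * (q:ℂ)^2)) *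
          Complex.exp (A * Complex.exp (θ * Complex.I) + B * Complex.exp (-(θ * Complex.I))) := by
    have e₀ : Complex.exp (-(θ * Complex.I)) = E (-θ) := by simp [hE]
    have e₁ (x : ℝ) : E (θ - x) = E θ * E (-x) := by rw [← E_add, sub_eq_add_neg]
    have e₂ (x : ℝ) : E (-(θ - x)) = E x * E (-θ) := by rw [← E_add]; ring_nf
    rw [e₀, show Complex.exp (θ * Complex.I) = E θ from rfl, E_cos, E_cos, e₁, e₁, e₂, e₂, hA, hB,
      mul_comm _ (ρ : ℂ), mul_assoc (ρ : ℂ), mul_assoc (ρ : ℂ)]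
    simp only [← Complex.exp_add]
    ring_nf
  have h := (hasSum_integral_exp_circle A B).mul_left ((1 / (Real.pi : ℂ)) *
    (ρ * Complex.exp (-((l : ℂ) - Complex.I * (f:ℂ)) * (ρ : ℂ) ^ 2)))
  simp only [hint, intervalIntegral.integral_const_mul]
  convert! h using 1
  · funext s; rw [hAB]; field_simp
  · rw [Complex.exp_neg]
    field_simp [Complex.exp_ne_zero]

theorem diffraction_integral_GRBF (l : ℝ) (hl : 0 < l) (f : ℝ) (q r : ℝ)
    (hq : 0 ≤ q) (hr : 0 ≤ r) (α φ : ℝ) :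
    ((1 / (Real.pi : ℂ)) *
        ∫ ρ in (0:ℝ)..1,
          (∫ θ in (0:ℝ)..(2 * Real.pi),
            Complex.exp (Complex.I * (f:ℂ) * (ρ:ℂ)^2)
              * Complex.exp (-(l : ℂ) * ((q:ℂ)^2 + (ρ:ℂ)^2 - 2 * (ρ:ℂ) * (q:ℂ) * (Real.cos (θ - α) : ℂ)))
              * Complex.exp (2 * (Real.pi : ℂ) * Complex.I * (r:ℂ) * (ρ:ℂ) * (Real.cos (θ - φ) : ℂ))
              * (ρ:ℂ))
      = Complex.exp (-(l : ℂ) * (q:ℂ)^2) *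
          ∑' s : ℕ,
            (m s ((l : ℂ) - Complex.I * (f:ℂ)) / ((Nat.factorial s : ℂ)) ^ 2)
              * (Om l r φ q α) ^ s)
    ∧ Summable (fun s : ℕ =>
        ‖(m s ((l : ℂ) - Complex.I * (f:ℂ)) / ((Nat.factorial s : ℂ)) ^ 2)
            * (Om l r φ q α) ^ s‖) := by
  refine ⟨?_, summable_norm_m_mul_pow _ _⟩
  rw [(hasSum_integral_radial ((l : ℂ) - Complex.I * (f:ℂ)) (Om l r φ q α)
    (hasSum_integral_angular l f q r α φ)).tsum_eq, intervalIntegral.integral_const_mul,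
    neg_mul (l : ℂ), Complex.exp_neg, mul_comm (1 / (Real.pi : ℂ)) (Complex.exp _),
    mul_assoc (Complex.exp _) (1 / (Real.pi : ℂ)),
    inv_mul_cancel_left₀ (Complex.exp_ne_zero _)]
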